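/- Let u be a solution of problem (1D). If there exist 0 < t0 < t1 ≤ +∞ such that u′(t) > 0 for all t ∈ (t0, t1) and u′(t0) = 0, then f(u(t0)) < 0. -/

import Mathlib

open Real Filter Set Topology MeasureTheory

/-- `Fint f t = ∫_0^t f(s) ds`. -/
noncomputable def Fint (f : ℝ → ℝ) (t : ℝ) : ℝ := ∫ s in (0:ℝ)..t, f s

/-- The zero set of `f` in `[0,∞)`. -/
def Zf (f : ℝ → ℝ) : Set ℝ := {z : ℝ | 0 ≤ z ∧ f z = 0}

/-- `f` is locally Lipschitz on the set `s`. -/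
def LocLipOn (f : ℝ → ℝ) (s : Set ℝ) : Prop :=
  ∀ x ∈ s, ∃ K : NNReal, ∃ t ∈ nhdsWithin x s, LipschitzOnWith K f t

/-- Condition (SMP): at every zero `z` of `f`,
`liminf_{t→z⁺} f(t)/(t−z)^{p−1} > −∞` and `limsup_{t→z⁻} f(t)/(z−t)^{p−1} < +∞`. -/
def SMP (p : ℝ) (f : ℝ → ℝ) : Prop :=
  ∀ z ∈ Zf f,
    (⊥ : EReal) <
      Filter.liminf (fun t : ℝ => ((f t / (t - z) ^ (p - 1) : ℝ) : EReal))
        (nhdsWithin z (Set.Ioi z)) ∧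
    Filter.limsup (fun t : ℝ => ((f t / (z - t) ^ (p - 1) : ℝ) : EReal))
      (nhdsWithin z (Set.Ico 0 z)) < (⊤ : EReal)

/-- A solution of problem (1D): a bounded nonnegative `C¹` function `u` on `[0,∞)`
with `u(0)=0`, derivative `u'`, such that `t ↦ |u'(t)|^{p−2} u'(t)` is differentiable
on `(0,∞)` with derivative `−f(u(t))` there. -/
structure Sol1D (p : ℝ) (f : ℝ → ℝ) (u u' : ℝ → ℝ) : Prop where
  hasDeriv : ∀ t ∈ Set.Ici (0:ℝ), HasDerivWithinAt u (u' t) (Set.Ici (0:ℝ)) t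
  derivCont : ContinuousOn u' (Set.Ici (0:ℝ))
  bounded : ∃ M : ℝ, ∀ t ∈ Set.Ici (0:ℝ), |u t| ≤ M
  zeroAtZero : u 0 = 0
  nonneg : ∀ t ∈ Set.Ici (0:ℝ), 0 ≤ u t
  ode : ∀ t ∈ Set.Ioi (0:ℝ),
    HasDerivAt (fun s : ℝ => |u' s| ^ (p - 2) * u' s) (-(f (u t))) t

/-- Under (SMP), where `f z ≥ 0` the function `f` is bounded below by `-C (s - z)^(p-1)`
to the right of `z`. -/
theorem SMP.exists_lower_bound {p : ℝ} {f : ℝ → ℝ} (hsmp : SMP p f)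
    (hfc : ContinuousOn f (Set.Ici 0)) {z : ℝ} (hz : 0 ≤ z) (hfz : 0 ≤ f z) :
    ∃ C : ℝ, 0 < C ∧ ∀ᶠ s in 𝓝[>] z, -C * (s - z) ^ (p - 1) ≤ f s := by
  rcases hfz.eq_or_lt with h | h
  · obtain ⟨c, -, hc⟩ := EReal.lt_iff_exists_real_btwn.1 (hsmp z ⟨hz, h.symm⟩).1
    refine ⟨|c| + 1, by positivity, ?_⟩
    filter_upwards [eventually_lt_of_lt_liminf hc, self_mem_nhdsWithin] with s hs hsz
    have hpos : 0 < (s - z) ^ (p - 1) := rpow_pos_of_pos (sub_pos.2 hsz) _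
    have hlt : c * (s - z) ^ (p - 1) < f s := (lt_div_iff₀ hpos).1 (EReal.coe_lt_coe_iff.1 hs)
    have : -(|c| + 1) * (s - z) ^ (p - 1) ≤ c * (s - z) ^ (p - 1) :=
      mul_le_mul_of_nonneg_right (by linarith [neg_abs_le c]) hpos.le
    linarith
  · refine ⟨1, one_pos, ?_⟩
    have hcont : Tendsto f (𝓝[>] z) (𝓝 (f z)) :=
      (hfc z hz).mono_left (nhdsWithin_mono _ fun s hs => hz.trans (le_of_lt hs))
    filter_upwards [hcont.eventually (lt_mem_nhds h), self_mem_nhdsWithin] with s hs hsz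
    have hpos : 0 < (s - z) ^ (p - 1) := rpow_pos_of_pos (sub_pos.2 hsz) _
    linarith

theorem Sol1D.hasDerivAt {p : ℝ} {f u u' : ℝ → ℝ} (hu : Sol1D p f u u') {t : ℝ} (ht : 0 < t) :
    HasDerivAt u (u' t) t :=
  (hu.hasDeriv t ht.le).hasDerivAt (Ici_mem_nhds ht)

theorem stmt3 (p : ℝ) (hp : 1 < p) (f : ℝ → ℝ)
    (hfc : ContinuousOn f (Set.Ici 0))
    (hflip : LocLipOn f (Set.Ici 0 \ Zf f))
    (hsmp : SMP p f)
    (u u' : ℝ → ℝ) (hu : Sol1D p f u u')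
    (t0 : ℝ) (t1 : EReal) (ht0 : 0 < t0) (ht01 : (t0 : EReal) < t1)
    (hpos : ∀ t : ℝ, t0 < t → (t : EReal) < t1 → 0 < u' t) (hd0 : u' t0 = 0) :
    f (u t0) < 0 := by
  by_contra! hf
  obtain ⟨C, hC, hlow⟩ := hsmp.exists_lower_bound hfc (hu.nonneg t0 ht0.le) hf
  obtain ⟨r, hr, hrlow⟩ := mem_nhdsGT_iff_exists_Ioo_subset.1 hlow
  have hnear : ∀ᶠ t in 𝓝[>] t0, u t < r :=
    ((hu.hasDerivAt ht0).continuousAt.eventually (gt_mem_nhds hr)).filter_mono nhdsWithin_le_nhds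
  obtain ⟨b, hb, hbr⟩ := mem_nhdsGT_iff_exists_Ioo_subset.1 hnear
  obtain ⟨a, ha0, ha1⟩ := EReal.lt_iff_exists_real_btwn.1 ht01
  replace ha0 : t0 < a := EReal.coe_lt_coe_iff.1 ha0
  obtain ⟨T, hT0, hT⟩ : ∃ T, t0 < T ∧ T < min (min a b) (t0 + min 1 C⁻¹) :=
    exists_between (lt_min (lt_min ha0 hb) (by have := inv_pos.2 hC; simp [hC]))
  simp only [lt_min_iff, ← min_add_add_left] at hT
  obtain ⟨⟨hTa, hTb⟩, hT1, hTC⟩ := hT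
  have hcont : ∀ {s t}, t0 ≤ s → ContinuousOn u (Icc s t) := fun hs x hx =>
    (hu.hasDerivAt (ht0.trans_le (hs.trans hx.1))).continuousAt.continuousWithinAt
  have hu'pos : ∀ t, t0 < t → t ≤ T → 0 < u' t := fun t h1 h2 =>
    hpos t h1 (lt_trans (EReal.coe_lt_coe_iff.2 (h2.trans_lt hTa)) ha1)
  have hmono : StrictMonoOn u (Icc t0 T) :=
    strictMonoOn_of_deriv_pos (convex_Icc _ _) (hcont le_rfl) fun x hx => by
      rw [interior_Icc] at hx
      rw [(hu.hasDerivAt (ht0.trans hx.1)).deriv]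
      exact hu'pos x hx.1 hx.2.le
  have hkey : ∀ t, t0 < t → t < T → u' t ≤ u t - u t0 := by
    intro t h1 h2
    obtain ⟨ξ, ⟨hξ0, hξt⟩, hξ⟩ := exists_hasDerivAt_eq_slope
      (fun s : ℝ => |u' s| ^ (p - 2) * u' s) (fun s => -(f (u s))) h1
      (fun x hx => (hu.ode x (ht0.trans_le hx.1)).continuousAt.continuousWithinAt)
      (fun x hx => hu.ode x (ht0.trans hx.1))
    have hut := hu'pos t h1 h2.le
    have hw : |u' t| ^ (p - 2) * u' t = u' t ^ (p - 1) := by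
      rw [abs_of_pos hut, ← rpow_add_one hut.ne']
      congr 1; ring
    simp only [hd0, mul_zero, sub_zero, hw] at hξ
    rw [eq_div_iff (sub_pos.2 h1).ne'] at hξ
    have hvξ : u t0 < u ξ :=
      hmono ⟨le_rfl, hT0.le⟩ ⟨hξ0.le, (hξt.trans h2).le⟩ hξ0
    have hvt : u ξ < u t := hmono ⟨hξ0.le, (hξt.trans h2).le⟩ ⟨h1.le, h2.le⟩ hξt
    have hfξ : -C * (u ξ - u t0) ^ (p - 1) ≤ f (u ξ) :=
      hrlow ⟨hvξ, hbr ⟨hξ0, (hξt.trans h2).trans hTb⟩⟩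
    have hpow : (u ξ - u t0) ^ (p - 1) ≤ (u t - u t0) ^ (p - 1) :=
      rpow_le_rpow (by linarith) (by linarith) (by linarith)
    have hvpos : 0 ≤ (u t - u t0) ^ (p - 1) := rpow_nonneg (by linarith) _
    have hCt : C * (t - t0) ≤ 1 :=
      calc C * (t - t0) ≤ C * C⁻¹ := by gcongr; linarith
        _ = 1 := mul_inv_cancel₀ hC.ne'
    have hle : u' t ^ (p - 1) ≤ (u t - u t0) ^ (p - 1) :=
      calc u' t ^ (p - 1) = -f (u ξ) * (t - t0) := hξ.symm
        _ ≤ (C * (u ξ - u t0) ^ (p - 1)) * (t - t0) :=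
          mul_le_mul_of_nonneg_right (by linarith) (by linarith)
        _ ≤ (C * (u t - u t0) ^ (p - 1)) * (t - t0) :=
          mul_le_mul_of_nonneg_right (by gcongr) (by linarith)
        _ = (C * (t - t0)) * (u t - u t0) ^ (p - 1) := by ring
        _ ≤ (u t - u t0) ^ (p - 1) := mul_le_of_le_one_left hvpos hCt
    exact (rpow_le_rpow_iff hut.le (by linarith) (by linarith)).1 hle
  obtain ⟨ξ, ⟨hξ0, hξT⟩, hξ⟩ := exists_hasDerivAt_eq_slope u u' hT0 (hcont le_rfl)
    (fun x hx => hu.hasDerivAt (ht0.trans hx.1))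
  rw [eq_div_iff (sub_pos.2 hT0).ne'] at hξ
  have h1 := hkey ξ hξ0 hξT
  have h2 : u ξ < u T := hmono ⟨hξ0.le, hξT.le⟩ ⟨hT0.le, le_rfl⟩ hξT
  have h3 : u' ξ * (T - t0) ≤ u' ξ :=
    mul_le_of_le_one_right (hu'pos ξ hξ0 hξT.le).le (by linarith)
  linarith
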